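/- Let Ω ⊂ ℝ² be a set of finite perimeter. For each 0 < δ < 1/2 set F(δ) := |log δ| P(Ω) - (1/2) ∫_Ω ∫_{Ωᶜ} g_δ(|x-y|)/|x-y|³ dy dx, where g_δ(r) = χ_{(δ,∞)}(r). Then for 0 < δ < δ̃ < 1/2, F(δ̃) ≤ F(δ). -/

import Mathlib

open MeasureTheory Real Filter Set

noncomputable section

/-- The plane `ℝ²`. -/
abbrev Plane := EuclideanSpace ℝ (Fin 2)

/-- Divergence of a vector field on the plane. -/
def divg (φ : Plane → Plane) (x : Plane) : ℝ :=
  ∑ i : Fin 2, fderiv ℝ φ x (EuclideanSpace.single i 1) i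

/-- The set of values `∫_Ω div φ` over admissible test vector fields. -/
def perimVals (Ω : Set Plane) : Set ℝ :=
  {s | ∃ φ : Plane → Plane, ContDiff ℝ 1 φ ∧ HasCompactSupport φ ∧
        (∀ x, ‖φ x‖ ≤ 1) ∧ s = ∫ x in Ω, divg φ x}

/-- The De Giorgi perimeter of a set in the plane. -/
def perim (Ω : Set Plane) : ℝ := sSup (perimVals Ω)

/-- A set has finite perimeter if the defining supremum is finite. -/
def HasFinPer (Ω : Set Plane) : Prop := BddAbove (perimVals Ω)

/-- The cutoff function `g_δ(r) = χ_{(δ,∞)}(r)`. -/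
def gdel (δ r : ℝ) : ℝ := if δ < r then 1 else 0

/-- Characteristic function of a set. -/
def ind (Ω : Set Plane) : Plane → ℝ := Set.indicator Ω 1

/-- The (rescaled) nonlocal dipolar term. -/
def nlE (δ : ℝ) (Ω : Set Plane) : ℝ :=
  ∫ x : Plane, ∫ z : Plane, |ind Ω (x + z) - ind Ω x| ^ 2 * (gdel δ ‖z‖ / ‖z‖ ^ 3)

/-- The energy `E_{λ,δ}`. -/
def Eenergy (lam δ : ℝ) (Ω : Set Plane) : ℝ :=
  perim Ω - lam / (4 * |Real.log δ|) * nlE δ Ω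

end

open scoped ENNReal

lemma integral_abs_cos_sub (α : ℝ) : ∫ θ in (-π)..π, |cos (θ - α)| = 4 := by
  have hper : Function.Periodic (fun θ => |cos θ|) (2 * π) := fun θ => by simp
  have hint : ∀ a b, IntervalIntegrable (fun θ => |cos θ|) volume a b := fun a b =>
    (by fun_prop : Continuous fun θ => |cos θ|).intervalIntegrable a b
  have e := hper.intervalIntegral_add_eq (-π - α) (-(π / 2))
  rw [show -π - α + 2 * π = π - α by ring, show -(π / 2) + 2 * π = 3 * π / 2 by ring] at e
  rw [intervalIntegral.integral_comp_sub_right (fun θ => |cos θ|), e,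
    ← intervalIntegral.integral_add_adjacent_intervals (hint _ (π / 2)) (hint _ _)]
  have hpi := Real.pi_pos
  have h1 : ∫ θ in (-(π / 2))..(π / 2), |cos θ| = ∫ θ in (-(π / 2))..(π / 2), cos θ :=
    intervalIntegral.integral_congr fun θ hθ => by
      rw [uIcc_of_le (by linarith)] at hθ
      exact abs_of_nonneg (cos_nonneg_of_mem_Icc hθ)
  have h2 : ∫ θ in (π / 2)..(3 * π / 2), |cos θ| = ∫ θ in (π / 2)..(3 * π / 2), -cos θ :=
    intervalIntegral.integral_congr fun θ hθ => by
      rw [uIcc_of_le (by linarith)] at hθ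
      exact abs_of_nonpos (cos_nonpos_of_pi_div_two_le_of_le hθ.1 (by linarith [hθ.2]))
  have h3 : sin (3 * π / 2) = -1 := by
    rw [show 3 * π / 2 = π / 2 + π by ring, sin_add_pi, sin_pi_div_two]
  rw [h1, h2, intervalIntegral.integral_neg, integral_cos, integral_cos, h3]
  simp
  norm_num

lemma lintegral_abs_cos_sub (α : ℝ) :
    ∫⁻ θ in Ioo (-π) π, ENNReal.ofReal |cos (θ - α)| = 4 := by
  have hpi := Real.pi_pos
  have hc : Continuous fun θ => |cos (θ - α)| := by fun_prop
  rw [restrict_Ioo_eq_restrict_Ioc, ← ofReal_integral_eq_lintegral_ofReal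
    ((intervalIntegrable_iff_integrableOn_Ioc_of_le (by linarith)).1 (hc.intervalIntegrable _ _))
    (Eventually.of_forall fun _ => abs_nonneg _),
    ← intervalIntegral.integral_of_le (by linarith), integral_abs_cos_sub]
  simp

/-- The kernel `|z|⁻³` restricted to the annulus `a < |z| ≤ b`. -/
noncomputable def ringKernel (a b : ℝ) (z : Plane) : ℝ≥0∞ :=
  (Ioc a b).indicator (fun r => ENNReal.ofReal (1 / r ^ 3)) ‖z‖

lemma measurable_ringKernel (a b : ℝ) : Measurable (ringKernel a b) := by
  have : Measurable ((Ioc a b).indicator (fun r : ℝ => ENNReal.ofReal (1 / r ^ 3))) :=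
    Measurable.indicator (by fun_prop) measurableSet_Ioc
  exact this.comp measurable_norm

lemma lintegral_ringKernel_radial {a b : ℝ} (ha : 0 < a) (hab : a ≤ b) :
    ∫⁻ r in Ioi (0 : ℝ), ENNReal.ofReal r *
      ((Ioc a b).indicator (fun r => ENNReal.ofReal (1 / r ^ 3)) r * ENNReal.ofReal r)
      = ENNReal.ofReal (log (b / a)) := by
  have h1 : ∀ r ∈ Ioi (0 : ℝ), ENNReal.ofReal r *
      ((Ioc a b).indicator (fun r => ENNReal.ofReal (1 / r ^ 3)) r * ENNReal.ofReal r)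
      = (Ioc a b).indicator (fun r => ENNReal.ofReal (1 / r)) r := by
    intro r hr
    have hr : 0 < r := hr
    by_cases h : r ∈ Ioc a b
    · simp only [indicator_of_mem h]
      rw [← ENNReal.ofReal_mul (by positivity), ← ENNReal.ofReal_mul (by positivity)]
      congr 1
      field_simp
    · simp [indicator_of_notMem h]
  rw [setLIntegral_congr_fun measurableSet_Ioi h1, lintegral_indicator measurableSet_Ioc,
    Measure.restrict_restrict measurableSet_Ioc,
    inter_eq_left.2 (show Ioc a b ⊆ Ioi 0 from fun r hr => ha.trans hr.1),
    ← ofReal_integral_eq_lintegral_ofReal, ← intervalIntegral.integral_of_le hab,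
    integral_one_div_of_pos ha (ha.trans_le hab)]
  · rw [← IntegrableOn, ← intervalIntegrable_iff_integrableOn_Ioc_of_le hab]
    refine intervalIntegral.intervalIntegrable_one_div (fun x hx => ?_) (by fun_prop)
    rw [uIcc_of_le hab] at hx
    exact (ha.trans_le hx.1).ne'
  · filter_upwards [ae_restrict_mem measurableSet_Ioc] with r hr
    have := ha.trans hr.1
    positivity

lemma inner_polarCoord_symm (w : ℂ) (p : ℝ × ℝ) :
    inner ℝ w (Complex.polarCoord.symm p) = ‖w‖ * (p.1 * cos (p.2 - w.arg)) := by
  have h1 := Complex.norm_mul_cos_arg w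
  have h2 := Complex.norm_mul_sin_arg w
  rw [Complex.inner, Complex.polarCoord_symm_apply, cos_sub]
  simp only [Complex.mul_re, Complex.mul_im, Complex.add_re, Complex.add_im, Complex.ofReal_re,
    Complex.ofReal_im, Complex.I_re, Complex.I_im, Complex.conj_re, Complex.conj_im]
  rw [← h1, ← h2]
  ring

lemma lintegral_ringKernel_mul_inner {a b : ℝ} (ha : 0 < a) (hab : a ≤ b) (w : Plane) :
    ∫⁻ z, ringKernel a b z * ‖inner ℝ w z‖ₑ = ENNReal.ofReal (4 * log (b / a)) * ‖w‖ₑ := by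
  set e : ℂ ≃ₗᵢ[ℝ] Plane := Complex.orthonormalBasisOneI.repr
  rw [← e.measurePreserving.lintegral_comp_emb e.toHomeomorph.measurableEmbedding,
    ← Complex.lintegral_comp_polarCoord_symm]
  obtain ⟨v, rfl⟩ := e.surjective w
  have h1 : ∀ p ∈ polarCoord.target, ENNReal.ofReal p.1 •
      (ringKernel a b (e (Complex.polarCoord.symm p)) *
        ‖inner ℝ (e v) (e (Complex.polarCoord.symm p))‖ₑ)
      = ‖v‖ₑ * ((ENNReal.ofReal p.1 * ((Ioc a b).indicator
          (fun r => ENNReal.ofReal (1 / r ^ 3)) p.1 * ENNReal.ofReal p.1)) *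
          ENNReal.ofReal |cos (p.2 - v.arg)|) := by
    intro p hp
    have hp0 : 0 < p.1 := hp.1
    rw [e.inner_map_map, inner_polarCoord_symm, enorm_mul, enorm_mul, ringKernel,
      e.norm_map, Complex.norm_polarCoord_symm, abs_of_pos hp0, enorm_norm,
      Real.enorm_eq_ofReal hp0.le, ← Real.enorm_abs, Real.enorm_eq_ofReal (abs_nonneg _),
      smul_eq_mul]
    ring
  have hm : Measurable ((Ioc a b).indicator (fun r : ℝ => ENNReal.ofReal (1 / r ^ 3))) :=
    Measurable.indicator (by fun_prop) measurableSet_Ioc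
  rw [setLIntegral_congr_fun polarCoord.open_target.measurableSet h1,
    lintegral_const_mul _ (by fun_prop), polarCoord_target, Measure.volume_eq_prod,
    ← Measure.prod_restrict, lintegral_prod_mul (f := fun r => ENNReal.ofReal r *
      ((Ioc a b).indicator (fun r => ENNReal.ofReal (1 / r ^ 3)) r * ENNReal.ofReal r))
      (g := fun θ => ENNReal.ofReal |cos (θ - v.arg)|) (by fun_prop) (by fun_prop),
    lintegral_ringKernel_radial ha hab, lintegral_abs_cos_sub, ← ofReal_norm (e v), e.norm_map,
    ofReal_norm, ENNReal.ofReal_mul (by norm_num)]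
  norm_num
  ring

lemma lintegral_enorm_shift_sub_le {u : Plane → ℝ} (hu : ContDiff ℝ 1 u) (z : Plane) :
    ∫⁻ x, ‖u (x + z) - u x‖ₑ ≤ ∫⁻ x, ‖fderiv ℝ u x z‖ₑ := by
  have hcd : Continuous fun x => fderiv ℝ u x z :=
    (hu.continuous_fderiv one_ne_zero).clm_apply continuous_const
  have hpt : ∀ x, ‖u (x + z) - u x‖ₑ ≤ ∫⁻ t in Ioc (0 : ℝ) 1, ‖fderiv ℝ u (x + t • z) z‖ₑ := by
    intro x
    have hd : ∀ t : ℝ, HasDerivAt (fun t : ℝ => u (x + t • z)) (fderiv ℝ u (x + t • z) z) t := by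
      intro t
      have h := (hu.differentiable one_ne_zero (x + t • z)).hasFDerivAt
      have h' : HasDerivAt (fun t : ℝ => x + t • z) z t := by
        simpa using ((hasDerivAt_id t).smul_const z).const_add x
      exact h.comp_hasDerivAt t h'
    have h := intervalIntegral.integral_eq_sub_of_hasDerivAt (a := 0) (b := 1) (fun t _ => hd t)
      ((hcd.comp (by fun_prop)).intervalIntegrable _ _)
    simp only [one_smul, zero_smul, add_zero] at h
    rw [← h, intervalIntegral.integral_of_le zero_le_one]
    exact enorm_integral_le_lintegral_enorm _
  refine (lintegral_mono hpt).trans ?_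
  rw [lintegral_lintegral_swap]
  · simp_rw [lintegral_add_right_eq_self (fun x => ‖fderiv ℝ u x z‖ₑ)]
    simp
  · have : Continuous fun p : Plane × ℝ => fderiv ℝ u (p.1 + p.2 • z) z := hcd.comp (by fun_prop)
    exact this.enorm.measurable.aemeasurable

/-- Averaged difference quotients of a `C¹` function over an annulus are controlled by the total
variation, with the sharp constant. -/
lemma lintegral_ringKernel_mul_shift_le {a b : ℝ} (ha : 0 < a) (hab : a ≤ b) {u : Plane → ℝ}
    (hu : ContDiff ℝ 1 u) :
    ∫⁻ z, ringKernel a b z * ∫⁻ x, ‖u (x + z) - u x‖ₑ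
      ≤ ENNReal.ofReal (4 * log (b / a)) * ∫⁻ x, ‖gradient u x‖ₑ := by
  have hc := hu.continuous_fderiv one_ne_zero
  have hg : Continuous (gradient u) :=
    (InnerProductSpace.toDual ℝ Plane).symm.continuous.comp hc
  have hm := measurable_ringKernel a b
  calc ∫⁻ z, ringKernel a b z * ∫⁻ x, ‖u (x + z) - u x‖ₑ
      ≤ ∫⁻ z, ringKernel a b z * ∫⁻ x, ‖inner ℝ (gradient u x) z‖ₑ := by
        refine lintegral_mono fun z => mul_le_mul_right ?_ _
        simpa [gradient] using lintegral_enorm_shift_sub_le hu z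
    _ = ∫⁻ z, ∫⁻ x, ringKernel a b z * ‖inner ℝ (gradient u x) z‖ₑ := by
        refine lintegral_congr fun z => (lintegral_const_mul _ ?_).symm
        exact (by fun_prop : Continuous fun x => inner ℝ (gradient u x) z).enorm.measurable
    _ = ∫⁻ x, ∫⁻ z, ringKernel a b z * ‖inner ℝ (gradient u x) z‖ₑ := by
        refine lintegral_lintegral_swap (Measurable.aemeasurable ?_)
        exact (hm.comp measurable_fst).mul
          (by fun_prop : Continuous fun p : Plane × Plane =>
            inner ℝ (gradient u p.2) p.1).enorm.measurable
    _ = _ := by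
        simp_rw [lintegral_ringKernel_mul_inner ha hab]
        rw [lintegral_const_mul _ hg.enorm.measurable]

lemma lintegral_le_of_ae_tendsto {α : Type*} [MeasurableSpace α] {μ : Measure α}
    {f : ℕ → α → ℝ≥0∞} {g : α → ℝ≥0∞} {C : ℝ≥0∞} (hf : ∀ n, AEMeasurable (f n) μ)
    (hC : ∀ n, ∫⁻ x, f n x ∂μ ≤ C)
    (hlim : ∀ᵐ x ∂μ, Tendsto (fun n => f n x) atTop (nhds (g x))) :
    ∫⁻ x, g x ∂μ ≤ C := by
  calc ∫⁻ x, g x ∂μ = ∫⁻ x, liminf (fun n => f n x) atTop ∂μ :=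
        lintegral_congr_ae (hlim.mono fun x hx => hx.liminf_eq.symm)
    _ ≤ liminf (fun n => ∫⁻ x, f n x ∂μ) atTop := lintegral_liminf_le' hf
    _ ≤ C := liminf_le_of_frequently_le' (Frequently.of_forall hC)

lemma continuous_divg {φ : Plane → Plane} (hφ : ContDiff ℝ 1 φ) : Continuous (divg φ) := by
  have hc := hφ.continuous_fderiv one_ne_zero
  unfold divg
  fun_prop

lemma hasCompactSupport_divg {φ : Plane → Plane} (hs : HasCompactSupport φ) :
    HasCompactSupport (divg φ) := by
  refine (hs.fderiv ℝ).mono fun x hx => ?_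
  contrapose! hx
  simp only [Function.mem_support, not_not] at hx
  simp [divg, hx]

lemma integrable_divg {φ : Plane → Plane} (hφ : ContDiff ℝ 1 φ) (hs : HasCompactSupport φ) :
    Integrable (divg φ) :=
  (continuous_divg hφ).integrable_of_hasCompactSupport (hasCompactSupport_divg hs)

lemma integral_mul_divg {u : Plane → ℝ} (hu : ContDiff ℝ 1 u) {φ : Plane → Plane}
    (hφ : ContDiff ℝ 1 φ) (hs : HasCompactSupport φ) :
    ∫ x, u x * divg φ x = -∫ x, inner ℝ (gradient u x) (φ x) := by
  have hcu := hu.continuous_fderiv one_ne_zero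
  have hcφ := hφ.continuous_fderiv one_ne_zero
  have hsi : ∀ i, HasCompactSupport fun x => φ x i := fun i =>
    hs.comp_left (g := fun v : Plane => v i) rfl
  have hdi : ∀ i x v, fderiv ℝ (fun x => φ x i) x v = fderiv ℝ φ x v i := by
    intro i x v
    have h := (EuclideanSpace.proj (𝕜 := ℝ) i).hasFDerivAt.comp x
      (hφ.differentiable one_ne_zero x).hasFDerivAt
    exact congrArg (fun L => L v) h.fderiv
  have hφi : ∀ i, ContDiff ℝ 1 fun x => φ x i := fun i =>
    (EuclideanSpace.proj (𝕜 := ℝ) i).contDiff.comp hφ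
  have hI1 : ∀ i, Integrable fun x => u x * fderiv ℝ φ x (EuclideanSpace.single i 1) i := fun i =>
    (by fun_prop : Continuous fun x => u x * fderiv ℝ φ x (EuclideanSpace.single i 1) i)
      |>.integrable_of_hasCompactSupport <| HasCompactSupport.mul_left <| by
        refine (hs.fderiv ℝ).mono fun x hx => ?_
        contrapose! hx
        simp only [Function.mem_support, not_not] at hx
        simp [hx]
  have hI2 : ∀ i, Integrable fun x => fderiv ℝ u x (EuclideanSpace.single i 1) * φ x i := fun i =>
    (by fun_prop : Continuous fun x => fderiv ℝ u x (EuclideanSpace.single i 1) * φ x i)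
      |>.integrable_of_hasCompactSupport <| (hsi i).mul_left
  have hibp : ∀ i, ∫ x, u x * fderiv ℝ φ x (EuclideanSpace.single i 1) i
      = -∫ x, fderiv ℝ u x (EuclideanSpace.single i 1) * φ x i := by
    intro i
    simp_rw [← hdi]
    refine integral_mul_fderiv_eq_neg_fderiv_mul_of_integrable (hI2 i) ?_ ?_
      (fun x _ => hu.differentiable one_ne_zero x)
      (fun x _ => (hφi i).differentiable one_ne_zero x)
    · simpa only [hdi] using hI1 i
    · exact (by fun_prop : Continuous fun x => u x * φ x i)
        |>.integrable_of_hasCompactSupport <| (hsi i).mul_left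
  have hinner : ∀ x, inner ℝ (gradient u x) (φ x)
      = ∑ i, fderiv ℝ u x (EuclideanSpace.single i 1) * φ x i := by
    intro x
    have hv : φ x = ∑ i, φ x i • EuclideanSpace.single i (1 : ℝ) := by
      ext j
      fin_cases j <;> simp
    have h : inner ℝ (gradient u x) (φ x) = fderiv ℝ u x (φ x) := by simp [gradient]
    rw [h]
    conv_lhs => rw [hv]
    simp [mul_comm]
  simp_rw [hinner, divg, Finset.mul_sum]
  rw [integral_finsetSum _ fun i _ => hI1 i, integral_finsetSum _ fun i _ => hI2 i,
    ← Finset.sum_neg_distrib]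
  exact Finset.sum_congr rfl fun i _ => hibp i

lemma tendsto_sq_div_sqrt_sq_add (s : ℝ) (hs : 0 ≤ s) :
    Tendsto (fun n : ℕ => s ^ 2 / √(s ^ 2 + 1 / ((n : ℝ) + 1))) atTop (nhds s) := by
  rcases hs.eq_or_lt with rfl | hs
  · simp
  have h : Tendsto (fun n : ℕ => s ^ 2 + 1 / ((n : ℝ) + 1)) atTop (nhds (s ^ 2 + 0)) :=
    tendsto_const_nhds.add tendsto_one_div_add_atTop_nhds_zero_nat
  have h' := (tendsto_const_nhds (x := s ^ 2)).div h.sqrt (by simpa [Real.sqrt_sq hs.le] using hs.ne')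
  have e : s ^ 2 / √(s ^ 2 + 0) = s := by
    rw [add_zero, Real.sqrt_sq hs.le, sq, mul_div_cancel_right₀ _ hs.ne']
  rwa [e] at h'

/-- If a `C²` function has total variation at most `P` in the distributional sense, then the
integral of the norm of its gradient is at most `P`. -/
lemma lintegral_enorm_gradient_le {u : Plane → ℝ} (hu : ContDiff ℝ 2 u) {P : ℝ}
    (hP : ∀ φ : Plane → Plane, ContDiff ℝ 1 φ → HasCompactSupport φ → (∀ x, ‖φ x‖ ≤ 1) →
      ∫ x, u x * divg φ x ≤ P) :
    ∫⁻ x, ‖gradient u x‖ₑ ≤ ENNReal.ofReal P := by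
  have hu1 : ContDiff ℝ 1 u := hu.of_le (by norm_num)
  have hg : ContDiff ℝ 1 (gradient u) :=
    (InnerProductSpace.toDual ℝ Plane).symm.contDiff.comp
      (hu.fderiv_right (m := 1) (by norm_num))
  let η : ℕ → ContDiffBump (0 : Plane) := fun n =>
    ⟨(n : ℝ) + 1, (n : ℝ) + 2, by positivity, by linarith⟩
  let q : ℕ → Plane → ℝ := fun n x => √(‖gradient u x‖ ^ 2 + 1 / ((n : ℝ) + 1))
  have hpos : ∀ (n : ℕ) x, 0 < ‖gradient u x‖ ^ 2 + 1 / ((n : ℝ) + 1) := fun n x =>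
    add_pos_of_nonneg_of_pos (sq_nonneg _) (by positivity)
  have hq : ∀ n x, 0 < q n x := fun n x => Real.sqrt_pos.2 (hpos n x)
  have hqc : ∀ n, ContDiff ℝ 1 (q n) := fun n =>
    ((hg.norm_sq ℝ).add contDiff_const).sqrt fun x => (hpos n x).ne'
  let ψ : ℕ → Plane → Plane := fun n x => -((η n x / q n x) • gradient u x)
  have hψ : ∀ n, ContDiff ℝ 1 (ψ n) := fun n =>
    (((η n).contDiff.div (hqc n) fun x => (hq n x).ne').smul hg).neg
  have hψs : ∀ n, HasCompactSupport (ψ n) := fun n => by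
    refine (η n).hasCompactSupport.mono fun x hx => ?_
    contrapose! hx
    simp only [Function.mem_support, not_not] at hx
    simp [ψ, hx]
  have hψ1 : ∀ n x, ‖ψ n x‖ ≤ 1 := by
    intro n x
    have h1 : ‖gradient u x‖ ≤ q n x := Real.le_sqrt_of_sq_le (by
      have : (0 : ℝ) < 1 / ((n : ℝ) + 1) := by positivity
      linarith)
    have h2 := (η n).le_one (x := x)
    have h3 := (η n).nonneg (x := x)
    simp only [ψ]
    rw [norm_neg, norm_smul, Real.norm_of_nonneg (div_nonneg h3 (hq n x).le), div_mul_eq_mul_div,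
      div_le_one (hq n x)]
    exact (mul_le_of_le_one_left (norm_nonneg _) h2).trans h1
  have hin : ∀ n x, -inner ℝ (gradient u x) (ψ n x) = η n x * (‖gradient u x‖ ^ 2 / q n x) := by
    intro n x
    simp only [ψ]
    rw [inner_neg_right, neg_neg, real_inner_smul_right, real_inner_self_eq_norm_sq]
    ring
  have hnn : ∀ n x, 0 ≤ η n x * (‖gradient u x‖ ^ 2 / q n x) := fun n x =>
    mul_nonneg (η n).nonneg (div_nonneg (sq_nonneg _) (hq n x).le)
  have hcont : ∀ n, Continuous fun x => η n x * (‖gradient u x‖ ^ 2 / q n x) := fun n =>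
    (η n).continuous.mul ((hg.continuous.norm.pow 2).div (hqc n).continuous fun x => (hq n x).ne')
  refine lintegral_le_of_ae_tendsto
    (f := fun n x => ENNReal.ofReal (η n x * (‖gradient u x‖ ^ 2 / q n x)))
    (fun n => (hcont n).measurable.ennreal_ofReal.aemeasurable) (fun n => ?_)
    (Eventually.of_forall fun x => ?_)
  · rw [← ofReal_integral_eq_lintegral_ofReal
      ((hcont n).integrable_of_hasCompactSupport (η n).hasCompactSupport.mul_right)
      (Eventually.of_forall (hnn n))]
    refine ENNReal.ofReal_le_ofReal ?_
    have h := hP (ψ n) (hψ n) (hψs n) (hψ1 n)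
    rw [integral_mul_divg hu1 (hψ n) (hψs n), ← integral_neg] at h
    simpa only [hin] using h
  · rw [← ofReal_norm]
    refine ENNReal.tendsto_ofReal ?_
    refine (tendsto_sq_div_sqrt_sq_add _ (norm_nonneg _)).congr' ?_
    obtain ⟨N, hN⟩ := exists_nat_ge ‖x‖
    filter_upwards [eventually_ge_atTop N] with n hn
    have hn' : (N : ℝ) ≤ n := by exact_mod_cast hn
    rw [(η n).one_of_mem_closedBall, one_mul]
    rw [mem_closedBall_zero_iff]
    exact hN.trans (hn'.trans (by simp [η]))

lemma measurable_ind {Ω : Set Plane} (hΩ : MeasurableSet Ω) : Measurable (ind Ω) :=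
  measurable_one.indicator hΩ

lemma norm_ind_le (Ω : Set Plane) (x : Plane) : ‖ind Ω x‖ ≤ 1 := by
  by_cases h : x ∈ Ω <;> simp [ind, h]

lemma locallyIntegrable_ind {Ω : Set Plane} (hΩ : MeasurableSet Ω) : LocallyIntegrable (ind Ω) :=
  (locallyIntegrable_const (1 : ℝ)).mono (measurable_ind hΩ).aestronglyMeasurable
    (Eventually.of_forall fun x => by simpa using norm_ind_le Ω x)

lemma divg_comp_add_right (φ : Plane → Plane) (t x : Plane) :
    divg (fun y => φ (y + t)) x = divg φ (x + t) := by
  simp [divg, fderiv_comp_add_right]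

lemma integral_ind_sub_mul_divg_le_perim {Ω : Set Plane} (hΩ : MeasurableSet Ω)
    (hfin : HasFinPer Ω) {φ : Plane → Plane} (hφ : ContDiff ℝ 1 φ) (hs : HasCompactSupport φ)
    (h1 : ∀ x, ‖φ x‖ ≤ 1) (t : Plane) :
    ∫ x, ind Ω (x - t) * divg φ x ≤ perim Ω := by
  have h : ∫ x, ind Ω (x - t) * divg φ x = ∫ x in Ω, divg (fun y => φ (y + t)) x := by
    rw [← integral_add_right_eq_self (fun x => ind Ω (x - t) * divg φ x) t,
      ← integral_indicator hΩ]
    refine integral_congr_ae (Eventually.of_forall fun x => ?_)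
    by_cases hx : x ∈ Ω <;> simp [ind, hx, divg_comp_add_right]
  rw [h]
  refine le_csSup hfin ⟨_, hφ.comp (contDiff_id.add contDiff_const), ?_, fun x => h1 _, rfl⟩
  exact hs.comp_homeomorph (Homeomorph.addRight t)

/-- Mollification does not increase the total variation of a characteristic function. -/
lemma integral_convolution_mul_divg_le {Ω : Set Plane} (hΩ : MeasurableSet Ω)
    (hfin : HasFinPer Ω) (ρ : ContDiffBump (0 : Plane)) {φ : Plane → Plane}
    (hφ : ContDiff ℝ 1 φ) (hs : HasCompactSupport φ) (h1 : ∀ x, ‖φ x‖ ≤ 1) :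
    ∫ x, convolution (ρ.normed volume) (ind Ω) (ContinuousLinearMap.lsmul ℝ ℝ) volume x * divg φ x
      ≤ perim Ω := by
  have hρ : Integrable (ρ.normed volume) := ρ.integrable_normed
  have hint : Integrable (Function.uncurry fun x t : Plane =>
      ρ.normed volume t * (ind Ω (x - t) * divg φ x)) (volume.prod volume) := by
    have h := ((integrable_divg hφ hs).mul_prod hρ).bdd_mul (c := 1)
      (f := fun p : Plane × Plane => ind Ω (p.1 - p.2))
      ((measurable_ind hΩ).comp (measurable_fst.sub measurable_snd)).aestronglyMeasurable
      (Eventually.of_forall fun p => norm_ind_le Ω _)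
    refine h.congr (Eventually.of_forall fun p => ?_)
    simp only [Function.uncurry]
    ring
  have hint' := hint.integral_prod_right
  simp only [Function.uncurry, integral_const_mul] at hint'
  calc _ = ∫ x, ∫ t, ρ.normed volume t * (ind Ω (x - t) * divg φ x) := by
        simp_rw [convolution_def, ← integral_mul_const]
        simp [mul_assoc]
    _ = ∫ t, ρ.normed volume t * ∫ x, ind Ω (x - t) * divg φ x := by
        rw [integral_integral_swap hint]
        simp_rw [integral_const_mul]
    _ ≤ ∫ t, ρ.normed volume t * perim Ω := by
        refine integral_mono hint' (hρ.mul_const _) fun t => ?_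
        exact mul_le_mul_of_nonneg_left
          (integral_ind_sub_mul_divg_le_perim hΩ hfin hφ hs h1 t) (ρ.nonneg_normed t)
    _ = perim Ω := by rw [integral_mul_const, ρ.integral_normed, one_mul]

lemma ae_prod_tendsto_shift_sub {u : ℕ → Plane → ℝ} {v : Plane → ℝ}
    (h : ∀ᵐ x, Tendsto (fun n => u n x) atTop (nhds (v x))) :
    ∀ᵐ p : Plane × Plane ∂(volume.prod volume),
      Tendsto (fun n => u n (p.2 + p.1) - u n p.2) atTop (nhds (v (p.2 + p.1) - v p.2)) := by
  have h2 := (Measure.quasiMeasurePreserving_snd (μ := (volume : Measure Plane))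
    (ν := (volume : Measure Plane))).ae h
  have h3 := (Measure.quasiMeasurePreserving_snd.comp
    (measurePreserving_prod_add (volume : Measure Plane)
      (volume : Measure Plane)).quasiMeasurePreserving).ae h
  filter_upwards [h2, h3] with p hp2 hp3
  simp only [Function.comp_apply, add_comm p.1] at hp3
  exact hp3.sub hp2

/-- A set of finite perimeter is approximated by smooth functions whose total variation does not
exceed its perimeter. -/
lemma exists_contDiff_approx {Ω : Set Plane} (hΩ : MeasurableSet Ω) (hfin : HasFinPer Ω) :
    ∃ u : ℕ → Plane → ℝ, (∀ n, ContDiff ℝ 2 (u n)) ∧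
      (∀ᵐ x, Tendsto (fun n => u n x) atTop (nhds (ind Ω x))) ∧
      ∀ n, ∫⁻ x, ‖gradient (u n) x‖ₑ ≤ ENNReal.ofReal (perim Ω) := by
  let ρ : ℕ → ContDiffBump (0 : Plane) := fun n =>
    ⟨1 / ((n : ℝ) + 1), 2 * (1 / ((n : ℝ) + 1)), by positivity, by
      have : (0 : ℝ) < 1 / ((n : ℝ) + 1) := by positivity
      linarith⟩
  have hu : ∀ n, ContDiff ℝ 2 (convolution ((ρ n).normed volume) (ind Ω)
      (ContinuousLinearMap.lsmul ℝ ℝ) volume) := fun n =>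
    (ρ n).hasCompactSupport_normed.contDiff_convolution_left (n := 2) _ (ρ n).contDiff_normed
      (locallyIntegrable_ind hΩ)
  refine ⟨_, hu, ?_, fun n => lintegral_enorm_gradient_le (hu n) fun φ hφ hs h1 =>
    integral_convolution_mul_divg_le hΩ hfin (ρ n) hφ hs h1⟩
  refine ContDiffBump.ae_convolution_tendsto_right_of_locallyIntegrable (K := 2) ?_
    (Eventually.of_forall fun n => le_rfl) (locallyIntegrable_ind hΩ)
  simpa [ρ] using (tendsto_one_div_add_atTop_nhds_zero_nat (𝕜 := ℝ)).const_mul 2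

lemma ringKernel_ne_top (a b : ℝ) (z : Plane) : ringKernel a b z ≠ ⊤ := by
  by_cases h : ‖z‖ ∈ Ioc a b <;> simp [ringKernel, indicator, h]

lemma measurable_ringKernel_mul_shift (a b : ℝ) {w : Plane → ℝ} (hw : Measurable w) :
    Measurable fun p : Plane × Plane => ringKernel a b p.1 * ‖w (p.2 + p.1) - w p.2‖ₑ :=
  ((measurable_ringKernel a b).comp measurable_fst).mul
    ((hw.comp (measurable_snd.add measurable_fst)).sub (hw.comp measurable_snd)).enorm

/-- The key inequality: the annular part of the nonlocal energy is controlled by the perimeter. -/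
lemma lintegral_ringKernel_mul_ind_le {Ω : Set Plane} (hΩ : MeasurableSet Ω) (hfin : HasFinPer Ω)
    {a b : ℝ} (ha : 0 < a) (hab : a ≤ b) :
    ∫⁻ z, ∫⁻ x, ringKernel a b z * ‖ind Ω (x + z) - ind Ω x‖ₑ
      ≤ ENNReal.ofReal (4 * log (b / a)) * ENNReal.ofReal (perim Ω) := by
  obtain ⟨u, hu, hlim, hgrad⟩ := exists_contDiff_approx hΩ hfin
  have hi := measurable_ringKernel_mul_shift a b (measurable_ind hΩ)
  have hm := fun n => measurable_ringKernel_mul_shift a b (hu n).continuous.measurable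
  refine (lintegral_prod _ hi.aemeasurable).symm.trans_le ?_
  refine lintegral_le_of_ae_tendsto (fun n => (hm n).aemeasurable) (fun n => ?_) ?_
  · have hc := (hu n).continuous
    calc _ = ∫⁻ z, ∫⁻ x, ringKernel a b z * ‖u n (x + z) - u n x‖ₑ :=
          lintegral_prod _ (hm n).aemeasurable
      _ = ∫⁻ z, ringKernel a b z * ∫⁻ x, ‖u n (x + z) - u n x‖ₑ :=
          lintegral_congr fun z => lintegral_const_mul _
            (by fun_prop : Continuous fun x => u n (x + z) - u n x).enorm.measurable
      _ ≤ ENNReal.ofReal (4 * log (b / a)) * ∫⁻ x, ‖gradient (u n) x‖ₑ :=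
          lintegral_ringKernel_mul_shift_le ha hab ((hu n).of_le (by norm_num))
      _ ≤ _ := mul_le_mul_right (hgrad n) _
  · filter_upwards [ae_prod_tendsto_shift_sub hlim] with p hp
    exact ENNReal.Tendsto.const_mul hp.enorm (Or.inr (ringKernel_ne_top a b p.1))

lemma enorm_ind_sub (Ω : Set Plane) (x y : Plane) :
    ‖ind Ω y - ind Ω x‖ₑ
      = Ωᶜ.indicator (fun _ => Ω.indicator 1 y) x + Ω.indicator (fun _ => Ωᶜ.indicator 1 y) x := by
  by_cases hx : x ∈ Ω <;> by_cases hy : y ∈ Ω <;> simp [ind, hx, hy]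

lemma measurable_kernel_mul_indicator {A B : Set Plane} (hA : MeasurableSet A)
    (hB : MeasurableSet B) {k : Plane → ℝ≥0∞} (hk : Measurable k) :
    Measurable fun p : Plane × Plane =>
      k p.1 * A.indicator (fun _ => B.indicator (1 : Plane → ℝ≥0∞) (p.2 + p.1)) p.2 := by
  have h : (fun p : Plane × Plane =>
      k p.1 * A.indicator (fun _ => B.indicator (1 : Plane → ℝ≥0∞) (p.2 + p.1)) p.2)
      = fun p => k p.1 * (A.indicator 1 p.2 * B.indicator 1 (p.2 + p.1)) := by
    ext p
    by_cases hp : p.2 ∈ A <;> simp [hp]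
  rw [h]
  exact (hk.comp measurable_fst).mul
    (((measurable_one.indicator hA).comp measurable_snd).mul
      ((measurable_one.indicator hB).comp (measurable_snd.add measurable_fst)))

lemma lintegral_kernel_mul_indicator {A B : Set Plane} (hA : MeasurableSet A)
    (hB : MeasurableSet B) {k : Plane → ℝ≥0∞} (hk : Measurable k) (heven : ∀ z, k (-z) = k z) :
    ∫⁻ z, ∫⁻ x, k z * A.indicator (fun _ => B.indicator 1 (x + z)) x
      = ∫⁻ x in A, ∫⁻ y in B, k (x - y) := by
  rw [lintegral_lintegral_swap (measurable_kernel_mul_indicator hA hB hk).aemeasurable,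
    ← lintegral_indicator hA]
  refine lintegral_congr fun x => ?_
  by_cases hx : x ∈ A
  · simp only [indicator_of_mem hx]
    rw [← lintegral_indicator hB, ← lintegral_add_right_eq_self (B.indicator fun y => k (x - y)) x]
    refine lintegral_congr fun z => ?_
    by_cases hz : z + x ∈ B
    · simp [hz, add_comm x z, heven]
    · simp [hz, add_comm x z]
  · simp [hx]

lemma ringKernel_neg (a b : ℝ) (z : Plane) : ringKernel a b (-z) = ringKernel a b z := by
  simp [ringKernel]

lemma lintegral_ringKernel_compl_le {Ω : Set Plane} (hΩ : MeasurableSet Ω) (hfin : HasFinPer Ω)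
    {a b : ℝ} (ha : 0 < a) (hab : a ≤ b) :
    2 * ∫⁻ x in Ω, ∫⁻ y in Ωᶜ, ringKernel a b (x - y)
      ≤ ENNReal.ofReal (4 * log (b / a)) * ENNReal.ofReal (perim Ω) := by
  have hk := measurable_ringKernel a b
  have hi := measurable_kernel_mul_indicator hΩ.compl hΩ hk
  refine le_trans (le_of_eq ?_) (lintegral_ringKernel_mul_ind_le hΩ hfin ha hab)
  have hswap : ∫⁻ x in Ωᶜ, ∫⁻ y in Ω, ringKernel a b (x - y)
      = ∫⁻ x in Ω, ∫⁻ y in Ωᶜ, ringKernel a b (x - y) := by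
    rw [lintegral_lintegral_swap (f := fun x y => ringKernel a b (x - y))
      (hk.comp (measurable_fst.sub measurable_snd)).aemeasurable]
    refine lintegral_congr fun y => lintegral_congr fun x => ?_
    rw [← ringKernel_neg, neg_sub]
  simp_rw [enorm_ind_sub, mul_add]
  rw [two_mul]
  nth_rw 1 [← hswap]
  rw [← lintegral_kernel_mul_indicator hΩ.compl hΩ hk (ringKernel_neg a b),
    ← lintegral_kernel_mul_indicator hΩ hΩ.compl hk (ringKernel_neg a b),
    ← lintegral_add_left hi.lintegral_prod_right']
  refine lintegral_congr fun z => (lintegral_add_left ?_ _).symm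
  exact hi.comp measurable_prodMk_left

lemma measurable_gdel_div (δ : ℝ) : Measurable fun z : Plane => gdel δ ‖z‖ / ‖z‖ ^ 3 := by
  unfold gdel
  exact (Measurable.ite (measurableSet_lt measurable_const measurable_norm) measurable_const
    measurable_const).div (by fun_prop)

lemma gdel_div_nonneg (δ : ℝ) (z : Plane) : 0 ≤ gdel δ ‖z‖ / ‖z‖ ^ 3 := by
  unfold gdel
  split_ifs <;> positivity

lemma integrable_gdel_div {δ : ℝ} (h0 : 0 < δ) :
    Integrable fun z : Plane => gdel δ ‖z‖ / ‖z‖ ^ 3 := by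
  have h : Integrable fun z : Plane => (1 + ‖z‖) ^ (-(3 : ℝ)) :=
    integrable_one_add_norm (by simp; norm_num)
  refine (h.const_mul (((1 + δ) / δ) ^ 3)).mono (measurable_gdel_div δ).aestronglyMeasurable
    (Eventually.of_forall fun z => ?_)
  rw [Real.norm_of_nonneg (gdel_div_nonneg δ z), Real.norm_of_nonneg (by positivity),
    Real.rpow_neg (by positivity), show (3 : ℝ) = (3 : ℕ) by norm_num, Real.rpow_natCast]
  unfold gdel
  split_ifs with hz
  · have hz0 : 0 < ‖z‖ := h0.trans hz
    rw [← div_eq_mul_inv, ← div_pow, ← one_div_pow]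
    refine pow_le_pow_left₀ (by positivity) ?_ 3
    rw [div_div, div_le_div_iff₀ hz0 (by positivity)]
    nlinarith
  · rw [zero_div]
    positivity

lemma ofReal_gdel_div_eq {a b : ℝ} (hab : a < b) (z : Plane) :
    ENNReal.ofReal (gdel a ‖z‖ / ‖z‖ ^ 3)
      = ENNReal.ofReal (gdel b ‖z‖ / ‖z‖ ^ 3) + ringKernel a b z := by
  unfold gdel ringKernel
  rcases le_or_gt ‖z‖ a with h1 | h1
  · simp [h1.not_gt, (h1.trans hab.le).not_gt]
  rcases le_or_gt ‖z‖ b with h2 | h2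
  · simp [h1, h2, h2.not_gt]
  · simp [h1, h2, h2.not_ge]

lemma integral_gdel_div_eq_toReal {Ω : Set Plane} {δ : ℝ} (h0 : 0 < δ) :
    ∫ x in Ω, ∫ y in Ωᶜ, gdel δ ‖x - y‖ / ‖x - y‖ ^ 3
      = (∫⁻ x in Ω, ∫⁻ y in Ωᶜ, ENNReal.ofReal (gdel δ ‖x - y‖ / ‖x - y‖ ^ 3)).toReal := by
  have hm : Measurable fun p : Plane × Plane => gdel δ ‖p.1 - p.2‖ / ‖p.1 - p.2‖ ^ 3 :=
    (measurable_gdel_div δ).comp (measurable_fst.sub measurable_snd)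
  rw [integral_eq_lintegral_of_nonneg_ae
    (Eventually.of_forall fun x => integral_nonneg fun y => gdel_div_nonneg δ _)
    hm.stronglyMeasurable.integral_prod_right'.aestronglyMeasurable]
  congr 1
  refine lintegral_congr fun x => ?_
  exact ofReal_integral_eq_lintegral_ofReal
    ((integrable_gdel_div h0).comp_sub_left x).integrableOn
    (Eventually.of_forall fun y => gdel_div_nonneg δ _)

lemma perim_nonneg {Ω : Set Plane} (hfin : HasFinPer Ω) : 0 ≤ perim Ω :=
  le_csSup hfin ⟨fun _ => 0, contDiff_const, HasCompactSupport.zero, by simp, by simp [divg]⟩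

/-- Monotonicity of `|log δ| E_{1,δ}(Ω)` in `δ`, written via the
set representation of the nonlocal term. -/
theorem stmt6 (Ω : Set Plane) (hmeas : MeasurableSet Ω) (hfin : HasFinPer Ω)
    (δ δ' : ℝ) (h0 : 0 < δ) (hlt : δ < δ') (h2 : δ' < 1 / 2) :
    |Real.log δ'| * perim Ω -
        (1 / 2) * ∫ x in Ω, ∫ y in Ωᶜ, gdel δ' ‖x - y‖ / ‖x - y‖ ^ 3
      ≤ |Real.log δ| * perim Ω -
          (1 / 2) * ∫ x in Ω, ∫ y in Ωᶜ, gdel δ ‖x - y‖ / ‖x - y‖ ^ 3 := by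
  have h0' : 0 < δ' := h0.trans hlt
  have hP := perim_nonneg hfin
  have hlog : 0 ≤ log (δ' / δ) := log_nonneg ((one_le_div h0).2 hlt.le)
  have hdiff : log (δ' / δ) = log δ' - log δ := log_div h0'.ne' h0.ne'
  rw [abs_of_neg (log_neg h0' (by linarith)), abs_of_neg (log_neg h0 (by linarith)),
    integral_gdel_div_eq_toReal h0, integral_gdel_div_eq_toReal h0']
  set L := ∫⁻ x in Ω, ∫⁻ y in Ωᶜ, ENNReal.ofReal (gdel δ ‖x - y‖ / ‖x - y‖ ^ 3) with hL
  set L' := ∫⁻ x in Ω, ∫⁻ y in Ωᶜ, ENNReal.ofReal (gdel δ' ‖x - y‖ / ‖x - y‖ ^ 3) with hL'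
  set A := ∫⁻ x in Ω, ∫⁻ y in Ωᶜ, ringKernel δ δ' (x - y) with hA
  have hA_le : 2 * A ≤ ENNReal.ofReal (4 * log (δ' / δ) * perim Ω) := by
    rw [ENNReal.ofReal_mul (by positivity)]
    exact lintegral_ringKernel_compl_le hmeas hfin h0 hlt.le
  have hm : Measurable fun p : Plane × Plane =>
      ENNReal.ofReal (gdel δ' ‖p.1 - p.2‖ / ‖p.1 - p.2‖ ^ 3) :=
    ((measurable_gdel_div δ').comp (measurable_fst.sub measurable_snd)).ennreal_ofReal
  have hsum : L = L' + A := by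
    rw [hL, hL', hA, ← lintegral_add_left hm.lintegral_prod_right']
    refine lintegral_congr fun x => ?_
    refine Eq.trans ?_ (lintegral_add_left (hm.comp measurable_prodMk_left) _)
    exact lintegral_congr fun y => ofReal_gdel_div_eq hlt _
  have hA_real : 2 * A.toReal ≤ 4 * log (δ' / δ) * perim Ω := by
    have h := ENNReal.toReal_mono ENNReal.ofReal_ne_top hA_le
    rwa [ENNReal.toReal_mul, ENNReal.toReal_ofReal (by positivity), ENNReal.toReal_ofNat] at h
  have hL_le : L.toReal ≤ L'.toReal + A.toReal := by
    rw [hsum]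
    exact ENNReal.toReal_add_le
  rw [hdiff] at hA_real
  linarith
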